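/- Let k be a field and let X, Y be geometrically integral k-varieties. If there exists a field extension L of k such that X_L is stably L-rational (i.e., X_L ×_L ℙⁿ_L is L-birational to ℙᵐ_L for some n, m), then there exists a finite field extension L' of k such that X_{L'} is stably L'-rational. -/

import Mathlib

open AlgebraicGeometry CategoryTheory CategoryTheory.Limits

/-- A field extension of `k`, bundled. -/
structure FieldExtension (k : Type) [Field k] : Type 1 where
  /-- the underlying field -/
  carrier : Type
  [field : Field carrier]
  [alg : Algebra k carrier]

attribute [instance] FieldExtension.field FieldExtension.alg

/-- The morphism `Spec F ⟶ Spec k` induced by a field extension `F/k`. -/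
noncomputable def specMap (k F : Type) [Field k] [Field F] [Algebra k F] :
    Spec (CommRingCat.of F) ⟶ Spec (CommRingCat.of k) :=
  Spec.map (CommRingCat.ofHom (algebraMap k F))

section
variable {k : Type} [Field k] {X : Scheme.{0}} (p : X ⟶ Spec (CommRingCat.of k))

/-- The base change `X_F` of a `k`-scheme `X` along a field extension `F/k`. -/
noncomputable def bc (F : Type) [Field F] [Algebra k F] : Scheme.{0} :=
  pullback p (specMap k F)

/-- The structure morphism of the base change `X_F ⟶ Spec F`. -/
noncomputable def bcStruct (F : Type) [Field F] [Algebra k F] :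
    bc p F ⟶ Spec (CommRingCat.of F) :=
  pullback.snd p (specMap k F)

end
attribute [local instance] MvPolynomial.gradedAlgebra

/-- Projective `n`-space over a field `k`, as a scheme. -/
noncomputable def ProjSpace (k : Type) [Field k] (n : ℕ) : Scheme.{0} :=
  Proj (MvPolynomial.homogeneousSubmodule (Fin (n + 1)) k)

/-- The structure morphism `ℙⁿ_k ⟶ Spec k`. -/
noncomputable def ProjSpace.structMap (k : Type) [Field k] (n : ℕ) :
    ProjSpace k n ⟶ Spec (CommRingCat.of k) :=
  Proj.toSpecZero _ ≫ Spec.map (CommRingCat.ofHom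
    (algebraMap k (MvPolynomial.homogeneousSubmodule (Fin (n + 1)) k 0)))

/-- A `k`-variety `X` becomes stably rational over a field extension `L/k`:
for some `n, m`, the product `X_L ×_L ℙⁿ_L` is birational over `L` to `ℙᵐ_L`,
i.e. they contain isomorphic nonempty open subschemes over `L`. -/
def StablyRationalOver {k : Type} [Field k] {X : Scheme.{0}}
    (pX : X ⟶ Spec (CommRingCat.of k)) (L : Type) [Field L] [Algebra k L] : Prop :=
  ∃ (n m : ℕ)
    (U : (pullback (bcStruct pX L) (ProjSpace.structMap L n)).Opens)
    (V : (ProjSpace L m).Opens), U ≠ ⊥ ∧ V ≠ ⊥ ∧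
    ∃ e : U.toScheme ≅ V.toScheme,
      e.hom ≫ V.ι ≫ ProjSpace.structMap L m =
        U.ι ≫ pullback.fst (bcStruct pX L) (ProjSpace.structMap L n) ≫ bcStruct pX L


section AlgebraPart
open TensorProduct

/-- `φ` exhibits `S` as the localization of `R` away from `f`. -/
def IsAwayHom {R S : Type} [CommRing R] [CommRing S] (φ : R →+* S) (f : R) : Prop :=
  IsUnit (φ f) ∧ (∀ s, ∃ (n : ℕ) (r : R), s * φ f ^ n = φ r) ∧
    (∀ r, φ r = 0 → ∃ n : ℕ, f ^ n * r = 0)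

theorem isAwayHom_iff {R S : Type} [CommRing R] [CommRing S] [Algebra R S] (f : R) :
    IsAwayHom (algebraMap R S) f ↔ IsLocalization.Away f S := by
  constructor
  · rintro ⟨h1, h2, h3⟩
    refine IsLocalization.Away.mk f h1 h2 fun a b hab => ?_
    obtain ⟨n, hn⟩ := h3 (a - b) (by rw [map_sub, hab, sub_self])
    exact ⟨n, by rwa [mul_sub, sub_eq_zero] at hn⟩
  · intro h
    refine ⟨IsLocalization.Away.algebraMap_isUnit f, fun s => IsLocalization.Away.surj f s,
      fun r hr => ?_⟩
    obtain ⟨n, hn⟩ := IsLocalization.Away.exists_of_eq (S := S) f (a := r) (b := 0) (by simpa using hr)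
    exact ⟨n, by simpa using hn⟩

theorem isAwayHom_iff' {R S : Type} [CommRing R] [CommRing S] (φ : R →+* S) (f : R) :
    IsAwayHom φ f ↔ @IsLocalization.Away _ _ f S _ φ.toAlgebra :=
  let := φ.toAlgebra
  isAwayHom_iff f

theorem IsAwayHom.comp_equiv {R R' S : Type} [CommRing R] [CommRing R'] [CommRing S]
    {φ : R →+* S} {f : R} (h : IsAwayHom φ f) (e : R' ≃+* R) :
    IsAwayHom (φ.comp e.toRingHom) (e.symm f) := by
  obtain ⟨h1, h2, h3⟩ := h
  refine ⟨by simpa using h1, fun s => ?_, fun r hr => ?_⟩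
  · obtain ⟨n, r, hr⟩ := h2 s
    exact ⟨n, e.symm r, by simpa using hr⟩
  · obtain ⟨n, hn⟩ := h3 (e r) (by simpa using hr)
    exact ⟨n, e.injective (by simpa using hn)⟩

theorem exists_coeffs {k L B : Type} [Field k] [Field L] [Algebra k L] [CommRing B] [Algebra k B]
    (x : L ⊗[k] B) : ∃ s : Finset L, ∀ A : Subalgebra k L, (s : Set L) ⊆ A →
      ∃ y : A ⊗[k] B, Algebra.TensorProduct.map A.val (AlgHom.id k B) y = x := by
  classical
  induction x with
  | zero => exact ⟨∅, fun A _ => ⟨0, by simp⟩⟩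
  | tmul l b =>
    refine ⟨{l}, fun A hA => ⟨(⟨l, hA (by simp)⟩ : A) ⊗ₜ b, by simp⟩⟩
  | add x y hx hy =>
    obtain ⟨s, hs⟩ := hx
    obtain ⟨t, ht⟩ := hy
    refine ⟨s ∪ t, fun A hA => ?_⟩
    obtain ⟨x', hx'⟩ := hs A (fun a ha => hA (by simp_all))
    obtain ⟨y', hy'⟩ := ht A (fun a ha => hA (by simp_all))
    exact ⟨x' + y', by rw [map_add, hx', hy']⟩

section
variable {k L B E : Type} [Field k] [Field L] [Algebra k L] [CommRing B] [Algebra k B]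
  [CommRing E] [Algebra L E]

/-- The restriction of `β` to `A ⊗ B`. -/
noncomputable def restr (β : L ⊗[k] B →ₐ[L] E) (A : Subalgebra k L) : A ⊗[k] B →ₐ[A] E :=
  (β.restrictScalars A).comp (Algebra.TensorProduct.map (Algebra.ofId A L) (AlgHom.id k B))

theorem restr_apply (β : L ⊗[k] B →ₐ[L] E) (A : Subalgebra k L) (x : A ⊗[k] B) :
    restr β A x = β (Algebra.TensorProduct.map A.val (AlgHom.id k B) x) := rfl

/-- The generators. -/
def gens (β : L ⊗[k] B →ₐ[L] E) (SB : Finset B) (w : E) : Set E :=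
  insert w ((fun b => β (1 ⊗ₜ b)) '' (SB : Set B))

theorem restr_mem (β : L ⊗[k] B →ₐ[L] E) (A : Subalgebra k L) (SB : Finset B)
    (hSB : Algebra.adjoin k (SB : Set B) = ⊤) (w : E) (x : A ⊗[k] B) :
    restr β A x ∈ Algebra.adjoin A (gens β SB w) := by
  induction x with
  | zero => simp
  | add x y hx hy => rw [map_add]; exact add_mem hx hy
  | tmul a b =>
    have : a ⊗ₜ[k] b = a • ((1 : A) ⊗ₜ[k] b) := by simp [TensorProduct.smul_tmul']
    rw [this, map_smul]
    clear this
    refine Subalgebra.smul_mem _ ?_ a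
    have hb : b ∈ Algebra.adjoin k (SB : Set B) := by rw [hSB]; trivial
    induction hb using Algebra.adjoin_induction with
    | mem b hb =>
      refine Algebra.subset_adjoin (Or.inr ⟨b, hb, ?_⟩)
      simp [restr_apply]
    | algebraMap r =>
      have : (1 : A) ⊗ₜ[k] (algebraMap k B r) = (algebraMap k A r) • (1 : A ⊗[k] B) := by
        rw [Algebra.algebraMap_eq_smul_one, TensorProduct.tmul_smul, algebraMap_smul]; rfl
      rw [this, map_smul, map_one]
      exact Subalgebra.smul_mem _ (one_mem _) _
    | add x y _ _ hx hy =>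
      rw [TensorProduct.tmul_add, map_add]; exact add_mem hx hy
    | mul x y _ _ hx hy =>
      have : (1 : A) ⊗ₜ[k] (x * y) = ((1 : A) ⊗ₜ x) * ((1 : A) ⊗ₜ y) := by simp
      rw [this, map_mul]; exact mul_mem hx hy

theorem exists_mem_adjoin (β : L ⊗[k] B →ₐ[L] E) (f : L ⊗[k] B)
    (hβ : IsAwayHom (β : L ⊗[k] B →+* E) f) (SB : Finset B)
    (hSB : Algebra.adjoin k (SB : Set B) = ⊤) (w : E) (hw : β f * w = 1) (e : E) :
    ∃ s : Finset L, ∀ A : Subalgebra k L, (s : Set L) ⊆ A →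
      e ∈ Algebra.adjoin A (gens β SB w) := by
  obtain ⟨n, r, hr⟩ := hβ.2.1 e
  obtain ⟨s, hs⟩ := exists_coeffs r
  refine ⟨s, fun A hA => ?_⟩
  obtain ⟨y, hy⟩ := hs A hA
  have : e = restr β A y * w ^ n := by
    rw [restr_apply, hy]
    have hr' : e * (β f) ^ n = β r := hr
    rw [← hr', mul_assoc, ← mul_pow, hw, one_pow, mul_one]
  rw [this]
  exact mul_mem (restr_mem β A SB hSB w y)
    (pow_mem (Algebra.subset_adjoin (Set.mem_insert _ _)) n)

theorem descend (β : L ⊗[k] B →ₐ[L] E) (f : L ⊗[k] B)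
    (hβ : IsAwayHom (β : L ⊗[k] B →+* E) f) (SB : Finset B)
    (hSB : Algebra.adjoin k (SB : Set B) = ⊤) (w : E) (hw : β f * w = 1) (A : Subalgebra k L)
    (f0 : A ⊗[k] B) (hf0 : Algebra.TensorProduct.map A.val (AlgHom.id k B) f0 = f)
    (S : Subalgebra A E) (hS : S = Algebra.adjoin A (gens β SB w)) :
    ∃ βA : A ⊗[k] B →ₐ[A] S, IsAwayHom (βA : A ⊗[k] B →+* S) f0 := by
  refine ⟨(restr β A).codRestrict S fun x => hS ▸ restr_mem β A SB hSB w x, ?_, ?_, ?_⟩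
  · have hwS : w ∈ S := hS ▸ Algebra.subset_adjoin (Or.inl rfl)
    refine IsUnit.of_mul_eq_one (⟨w, hwS⟩ : S) (Subtype.ext ?_)
    simpa [restr_apply, hf0] using hw
  · suffices h : ∀ s ∈ S, ∃ (n : ℕ) (r : A ⊗[k] B), s * (β f) ^ n = restr β A r by
      rintro ⟨s, hs⟩
      obtain ⟨n, r, hr⟩ := h s hs
      refine ⟨n, r, Subtype.ext ?_⟩
      simpa [restr_apply, hf0] using hr
    intro s hs
    rw [hS] at hs
    have hff : restr β A f0 = β f := by rw [restr_apply, hf0]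
    induction hs using Algebra.adjoin_induction with
    | mem x hx =>
      rcases hx with rfl | ⟨b, _, rfl⟩
      · exact ⟨1, 1, by simpa [mul_comm] using hw⟩
      · exact ⟨0, 1 ⊗ₜ b, by simp [restr_apply]⟩
    | algebraMap r => exact ⟨0, algebraMap _ _ r, by rw [AlgHom.commutes]; simp⟩
    | add x y _ _ hx hy =>
      obtain ⟨n, r, hr⟩ := hx
      obtain ⟨m, t, ht⟩ := hy
      refine ⟨n + m, r * f0 ^ m + t * f0 ^ n, ?_⟩
      rw [map_add, map_mul, map_mul, map_pow, map_pow, hff, ← hr, ← ht]; ring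
    | mul x y _ _ hx hy =>
      obtain ⟨n, r, hr⟩ := hx
      obtain ⟨m, t, ht⟩ := hy
      refine ⟨n + m, r * t, ?_⟩
      rw [map_mul, ← hr, ← ht]; ring
  · intro r hr
    have hr' : β (Algebra.TensorProduct.map A.val (AlgHom.id k B) r) = 0 := by
      simpa [restr_apply] using congrArg Subtype.val hr
    obtain ⟨n, hn⟩ := hβ.2.2 _ hr'
    refine ⟨n, ?_⟩
    have hinj : Function.Injective (Algebra.TensorProduct.map A.val (AlgHom.id k B)) :=
      Module.Flat.rTensor_preserves_injective_linearMap (M := B) A.val.toLinearMap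
        Subtype.val_injective
    apply hinj
    rw [map_mul, map_pow, hf0, hn, map_zero]

end

theorem baseChange_away {k A B S L' : Type} [Field k] [CommRing A] [Algebra k A] [CommRing B]
    [Algebra k B] [CommRing S] [Algebra A S] [Field L'] [Algebra k L'] [Algebra A L']
    [IsScalarTower k A L'] (βA : A ⊗[k] B →ₐ[A] S) (f0 : A ⊗[k] B)
    (h : IsAwayHom (βA : A ⊗[k] B →+* S) f0) :
    ∃ (β' : L' ⊗[k] B →ₐ[L'] L' ⊗[A] S) (f' : L' ⊗[k] B),
      IsAwayHom (β' : L' ⊗[k] B →+* L' ⊗[A] S) f' := by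
  let e : L' ⊗[A] (A ⊗[k] B) ≃ₐ[L'] L' ⊗[k] B :=
    Algebra.TensorProduct.cancelBaseChange k A L' L' B
  let m : L' ⊗[A] (A ⊗[k] B) →ₐ[L'] L' ⊗[A] S :=
    Algebra.TensorProduct.map (AlgHom.id L' L') βA
  have hm : IsAwayHom (m : L' ⊗[A] (A ⊗[k] B) →+* L' ⊗[A] S) (1 ⊗ₜ f0) := by
    let := (βA : A ⊗[k] B →+* S).toAlgebra
    let := (m : L' ⊗[A] (A ⊗[k] B) →+* L' ⊗[A] S).toAlgebra
    have : IsScalarTower A (A ⊗[k] B) S := .of_algebraMap_eq fun x => (βA.commutes x).symm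
    have : IsScalarTower L' (L' ⊗[A] (A ⊗[k] B)) (L' ⊗[A] S) :=
      .of_algebraMap_eq fun x => (m.commutes x).symm
    have : IsLocalization.Away f0 S := (isAwayHom_iff f0).1 h
    have := IsLocalization.tensorProduct_tensorProduct_right A L' (Submonoid.powers f0) S (by
      ext x
      · change m (1 ⊗ₜ _) = 1 ⊗ₜ (βA _)
        simp [m]
      · change m (1 ⊗ₜ _) = 1 ⊗ₜ (βA _)
        simp [m])
    rw [Submonoid.map_powers] at this
    exact (isAwayHom_iff _).2 this
  exact ⟨m.comp e.symm.toAlgHom, _, hm.comp_equiv e.symm.toRingEquiv⟩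

theorem core_final {k A S B C : Type} [Field k] [CommRing A] [Algebra k A] [CommRing S]
    [Algebra A S] [CommRing B] [Algebra k B] [CommRing C] [Algebra k C] [Nontrivial S]
    [Algebra.FiniteType k A] [Algebra.FiniteType A S]
    (βA : A ⊗[k] B →ₐ[A] S) (f0 : A ⊗[k] B) (hβA : IsAwayHom (βA : A ⊗[k] B →+* S) f0)
    (γA : A ⊗[k] C →ₐ[A] S) (g0 : A ⊗[k] C) (hγA : IsAwayHom (γA : A ⊗[k] C →+* S) g0) :
    ∃ (L' : Type) (_ : Field L') (_ : Algebra k L') (D : Type) (_ : CommRing D)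
      (_ : Algebra L' D) (β' : L' ⊗[k] B →ₐ[L'] D) (f' : L' ⊗[k] B)
      (γ' : L' ⊗[k] C →ₐ[L'] D) (g' : L' ⊗[k] C),
      FiniteDimensional k L' ∧ Nontrivial D ∧ IsAwayHom (β' : L' ⊗[k] B →+* D) f' ∧
      IsAwayHom (γ' : L' ⊗[k] C →+* D) g' := by
  let : Algebra k S := ((algebraMap A S).comp (algebraMap k A)).toAlgebra
  have : IsScalarTower k A S := .of_algebraMap_eq fun _ => rfl
  have : Algebra.FiniteType k S := Algebra.FiniteType.trans (S := A) inferInstance inferInstance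
  obtain ⟨m, hm⟩ := Ideal.exists_maximal S
  let := Ideal.Quotient.field m
  have : Algebra.FiniteType k (S ⧸ m) :=
    Algebra.FiniteType.of_surjective (Ideal.Quotient.mkₐ k m) Ideal.Quotient.mk_surjective
  have : Module.Finite k (S ⧸ m) := finite_of_finite_type_of_isJacobsonRing k (S ⧸ m)
  have : IsScalarTower k A (S ⧸ m) := .of_algebraMap_eq fun _ => rfl
  obtain ⟨β', f', h1⟩ := baseChange_away (L' := S ⧸ m) βA f0 hβA
  obtain ⟨γ', g', h2⟩ := baseChange_away (L' := S ⧸ m) γA g0 hγA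
  refine ⟨S ⧸ m, inferInstance, inferInstance, (S ⧸ m) ⊗[A] S, inferInstance, inferInstance,
    β', f', γ', g', inferInstance, ?_, h1, h2⟩
  exact (Algebra.TensorProduct.lift (AlgHom.id A (S ⧸ m)) (Ideal.Quotient.mkₐ A m)
    fun _ _ => Commute.all _ _).toRingHom.domain_nontrivial

theorem core_algebra {k L B C E : Type} [Field k] [Field L] [Algebra k L] [CommRing B]
    [Algebra k B] [CommRing C] [Algebra k C] [Algebra.FiniteType k B] [Algebra.FiniteType k C]
    [CommRing E] [Algebra L E] [Nontrivial E]
    (β : L ⊗[k] B →ₐ[L] E) (f : L ⊗[k] B) (hβ : IsAwayHom (β : L ⊗[k] B →+* E) f)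
    (γ : L ⊗[k] C →ₐ[L] E) (g : L ⊗[k] C) (hγ : IsAwayHom (γ : L ⊗[k] C →+* E) g) :
    ∃ (L' : Type) (_ : Field L') (_ : Algebra k L') (D : Type) (_ : CommRing D)
      (_ : Algebra L' D) (β' : L' ⊗[k] B →ₐ[L'] D) (f' : L' ⊗[k] B)
      (γ' : L' ⊗[k] C →ₐ[L'] D) (g' : L' ⊗[k] C),
      FiniteDimensional k L' ∧ Nontrivial D ∧ IsAwayHom (β' : L' ⊗[k] B →+* D) f' ∧
      IsAwayHom (γ' : L' ⊗[k] C →+* D) g' := by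
  classical
  obtain ⟨SB, hSB⟩ := ‹Algebra.FiniteType k B›.out
  obtain ⟨SC, hSC⟩ := ‹Algebra.FiniteType k C›.out
  obtain ⟨w, hw⟩ := hβ.1.exists_right_inv
  obtain ⟨v, hv⟩ := hγ.1.exists_right_inv
  obtain ⟨s1, hs1⟩ := exists_coeffs f
  obtain ⟨s2, hs2⟩ := exists_coeffs g
  have hfin : ∀ (P : E → Subalgebra k L → Prop),
      (∀ e, ∃ s : Finset L, ∀ A : Subalgebra k L, (s : Set L) ⊆ A → P e A) →
      ∀ T : Set E, T.Finite → ∃ s : Finset L, ∀ A : Subalgebra k L, (s : Set L) ⊆ A →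
        ∀ e ∈ T, P e A := by
    intro P hP T hT
    choose s hs using hP
    refine ⟨hT.toFinset.biUnion s, fun A hA e he => hs e A fun x hx => hA ?_⟩
    simp only [Finset.coe_biUnion, Set.mem_iUnion]
    exact ⟨e, by simpa using he, hx⟩
  have fB : (gens β SB w).Finite := ((SB.finite_toSet).image _).insert _
  have fC : (gens γ SC v).Finite := ((SC.finite_toSet).image _).insert _
  obtain ⟨s3, hs3⟩ := hfin _ (exists_mem_adjoin β f hβ SB hSB w hw) _ fC
  obtain ⟨s4, hs4⟩ := hfin _ (exists_mem_adjoin γ g hγ SC hSC v hv) _ fB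
  let s := s1 ∪ s2 ∪ s3 ∪ s4
  let A : Subalgebra k L := Algebra.adjoin k (s : Set L)
  have hA : (s : Set L) ⊆ A := Algebra.subset_adjoin
  obtain ⟨f0, hf0⟩ := hs1 A fun x hx => hA (by simp [s, Finset.mem_coe.1 hx])
  obtain ⟨g0, hg0⟩ := hs2 A fun x hx => hA (by simp [s, Finset.mem_coe.1 hx])
  have h3 := hs3 A fun x hx => hA (by simp [s, Finset.mem_coe.1 hx])
  have h4 := hs4 A fun x hx => hA (by simp [s, Finset.mem_coe.1 hx])
  obtain ⟨S, hS⟩ : ∃ S, S = Algebra.adjoin A (gens β SB w) := ⟨_, rfl⟩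
  have hS' : S = Algebra.adjoin A (gens γ SC v) := by
    rw [hS]
    exact le_antisymm (Algebra.adjoin_le h4) (Algebra.adjoin_le h3)
  obtain ⟨βA, hβA⟩ := descend β f hβ SB hSB w hw A f0 hf0 S hS
  obtain ⟨γA, hγA⟩ := descend γ g hγ SC hSC v hv A g0 hg0 S hS'
  have : Algebra.FiniteType k A := ⟨(Subalgebra.fg_top A).2 ⟨s, rfl⟩⟩
  have : Algebra.FiniteType A S := ⟨(Subalgebra.fg_top S).2 (hS ▸ ⟨fB.toFinset, by simp⟩)⟩
  exact core_final βA f0 hβA γA g0 hγA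

end AlgebraPart

section ProjPart
open MvPolynomial

theorem homog_eval₂ {σ R S : Type} [CommRing R] [CommRing S] (c : R →+* S) (x : σ → S) (u : S)
    (n : ℕ) (a : MvPolynomial σ R) (ha : a.IsHomogeneous n) :
    eval₂ c (fun j => x j * u) a = eval₂ c x a * u ^ n := by
  rw [eval₂_eq, eval₂_eq, Finset.sum_mul]
  refine Finset.sum_congr rfl fun d hd => ?_
  have hn : ∑ i ∈ d.support, d i = n := by
    have := ha (mem_support_iff.1 hd)
    simpa [Finsupp.weight_apply, Finsupp.sum] using this
  rw [mul_assoc]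
  congr 1
  simp only [mul_pow]
  rw [Finset.prod_mul_distrib, Finset.prod_pow_eq_pow_sum, ← hn]

section
variable (L : Type) [Field L] (n : ℕ) (i : Fin (n + 1))

/-- the coordinate ring of the standard chart -/
abbrev AwayRing : Type :=
  HomogeneousLocalization.Away (homogeneousSubmodule (Fin (n + 1)) L) (X i : MvPolynomial (Fin (n+1)) L)

/-- constants in the coordinate ring of a standard chart -/
noncomputable def constHom : L →+* AwayRing L n i :=
  (HomogeneousLocalization.fromZeroRingHom (homogeneousSubmodule (Fin (n + 1)) L) _).comp
    (algebraMap L (homogeneousSubmodule (Fin (n + 1)) L 0))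

theorem X_mem (j : Fin (n + 1)) :
    (X j : MvPolynomial (Fin (n + 1)) L) ∈ homogeneousSubmodule (Fin (n + 1)) L 1 :=
  isHomogeneous_X L j

/-- the chart comparison -/
noncomputable def chartHom : MvPolynomial {j : Fin (n + 1) // j ≠ i} L →+* AwayRing L n i :=
  eval₂Hom (constHom L n i) fun j =>
    HomogeneousLocalization.Away.mk _ (X_mem L n i) 1 (X j.1) (X_mem L n j.1)

/-- dehomogenization -/
noncomputable def dehom : MvPolynomial (Fin (n + 1)) L →+* MvPolynomial {j : Fin (n + 1) // j ≠ i} L :=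
  eval₂Hom C fun j => if h : j ≠ i then X ⟨j, h⟩ else 1

/-- dehomogenization on the chart -/
noncomputable def chartInv : AwayRing L n i →+* MvPolynomial {j : Fin (n + 1) // j ≠ i} L :=
  (IsLocalization.Away.lift (S := Localization.Away (X i : MvPolynomial (Fin (n+1)) L)) (X i)
    (g := dehom L n i) (by simp [dehom])).comp
    (algebraMap (AwayRing L n i) (Localization.Away (X i : MvPolynomial (Fin (n+1)) L)))

theorem val_const (a : L) : (constHom L n i a).val = algebraMap (MvPolynomial (Fin (n + 1)) L) _ (C a) := by
  rfl

theorem val_eq_lift (a : MvPolynomial (Fin (n + 1)) L) :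
    (chartHom L n i (dehom L n i a)).val = eval₂
      ((algebraMap (MvPolynomial (Fin (n + 1)) L) (Localization.Away (X i : MvPolynomial (Fin (n+1)) L))).comp C)
      (fun j => algebraMap (MvPolynomial (Fin (n + 1)) L) _ (X j) *
        IsLocalization.Away.invSelf (X i : MvPolynomial (Fin (n + 1)) L)) a := by
  change ((algebraMap (AwayRing L n i) (Localization.Away (X i : MvPolynomial (Fin (n+1)) L))).comp
    ((chartHom L n i).comp (dehom L n i))) a = eval₂Hom _ _ a
  congr 1
  ext j
  · simp [chartHom, dehom]
    rfl
  · simp only [dehom, chartHom, RingHom.comp_apply, eval₂Hom_X']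
    by_cases h : j = i
    · subst h
      simp [IsLocalization.Away.mul_invSelf]
    · simp only [ne_eq, h, not_false_eq_true, dite_true, eval₂Hom_X']
      change (HomogeneousLocalization.Away.mk _ (X_mem L n i) 1 (X j) (X_mem L n j)).val = _
      rw [HomogeneousLocalization.Away.val_mk, Localization.mk_eq_mk']
      rw [IsLocalization.mk'_eq_iff_eq_mul]
      simp only [pow_one]
      rw [mul_assoc, mul_comm (IsLocalization.Away.invSelf _), IsLocalization.Away.mul_invSelf, mul_one]

theorem chartHom_bijective : Function.Bijective (chartHom L n i) := by
  constructor
  · have : (chartInv L n i).comp (chartHom L n i) = RingHom.id _ := by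
      ext j
      · simp only [chartHom, chartInv, RingHom.comp_apply, eval₂Hom_C]
        change coeff _ (IsLocalization.Away.lift _ _ (constHom L n i _).val) = _
        rw [val_const, IsLocalization.Away.lift_eq]
        simp [dehom]
      · simp only [chartHom, chartInv, RingHom.comp_apply, eval₂Hom_X']
        change coeff _ (IsLocalization.Away.lift _ _
          (HomogeneousLocalization.Away.mk _ (X_mem L n i) 1 (X j.1) (X_mem L n j.1)).val) = _
        rw [HomogeneousLocalization.Away.val_mk]
        congr 1
        have h := IsLocalization.mk'_spec (M := Submonoid.powers (X i : MvPolynomial (Fin (n+1)) L))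
          (Localization.Away (X i : MvPolynomial (Fin (n+1)) L)) (X j.1) ⟨X i ^ 1, 1, rfl⟩
        have h' := congrArg (IsLocalization.Away.lift (S := Localization.Away (X i : MvPolynomial (Fin (n+1)) L)) (X i)
            (g := dehom L n i) (by simp [dehom])) h
        rw [map_mul, IsLocalization.Away.lift_eq, IsLocalization.Away.lift_eq] at h'
        rw [Localization.mk_eq_mk']
        simpa [dehom, j.2] using h'
    exact Function.LeftInverse.injective (g := chartInv L n i) fun x => congrArg (fun φ => φ x) this
  · intro z
    obtain ⟨d, a, ha, rfl⟩ := HomogeneousLocalization.Away.mk_surjective _ (X_mem L n i) z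
    refine ⟨dehom L n i a, ?_⟩
    apply HomogeneousLocalization.val_injective
    rw [val_eq_lift, HomogeneousLocalization.Away.val_mk, Localization.mk_eq_mk',
      IsLocalization.eq_mk'_iff_mul_eq]
    have ha' : a.IsHomogeneous d := by simpa using ha
    rw [homog_eval₂ _ _ _ _ _ ha', map_pow, mul_assoc, ← mul_pow, mul_comm (IsLocalization.Away.invSelf _),
      IsLocalization.Away.mul_invSelf, one_pow, mul_one]
    change eval₂Hom _ _ a = _
    conv_rhs => rw [← RingHom.comp_id (algebraMap _ _)]
    congr 1
    ext <;> simp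
end

end ProjPart

section GeoPart
open TensorProduct

theorem IsAwayHom.isOpenImmersion {R S : Type} [CommRing R] [CommRing S] {φ : R →+* S} {f : R}
    (h : IsAwayHom φ f) : IsOpenImmersion (Spec.map (CommRingCat.ofHom φ)) := by
  let := φ.toAlgebra
  have : IsLocalization.Away f S := (isAwayHom_iff f).1 h
  exact IsOpenImmersion.of_isLocalization f

theorem IsAwayHom.equiv_comp {R S S' : Type} [CommRing R] [CommRing S] [CommRing S']
    {φ : R →+* S} {f : R} (h : IsAwayHom φ f) (e : S ≃+* S') :
    IsAwayHom (e.toRingHom.comp φ) f := by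
  obtain ⟨h1, h2, h3⟩ := h
  refine ⟨by simpa using h1.map e, fun s => ?_, fun r hr => h3 r (by simpa using hr)⟩
  obtain ⟨n, r, hr⟩ := h2 (e.symm s)
  exact ⟨n, r, e.symm.injective (by simpa using hr)⟩

theorem isAwayHom_of_range {R S : Type} [CommRing R] [CommRing S] (φ : R →+* S) (f : R)
    [IsOpenImmersion (Spec.map (CommRingCat.ofHom φ))]
    (h : (Spec.map (CommRingCat.ofHom φ)).opensRange = PrimeSpectrum.basicOpen f) :
    IsAwayHom φ f := by
  let j := Spec.map (CommRingCat.ofHom (algebraMap R (Localization.Away f)))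
  have hj : Set.range j = Set.range (Spec.map (CommRingCat.ofHom φ)) := by
    have := (Scheme.Hom.opensRange_localizationAway (R := .of R) f).trans h.symm
    exact congrArg (fun U : (Spec (CommRingCat.of R)).Opens => U.carrier) this
  let e := IsOpenImmersion.isoOfRangeEq j (Spec.map (CommRingCat.ofHom φ)) hj
  have he : e.inv ≫ j = Spec.map (CommRingCat.ofHom φ) :=
    IsOpenImmersion.isoOfRangeEq_inv_fac _ _ _
  let a := Spec.preimage e.hom
  let b := Spec.preimage e.inv
  have hab : a ≫ b = 𝟙 _ := Spec.map_injective (by simp [a, b, Spec.map_comp])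
  have hba : b ≫ a = 𝟙 _ := Spec.map_injective (by simp [a, b, Spec.map_comp])
  let ε : Localization.Away f ≃+* S := RingEquiv.ofRingHom b.hom a.hom
    (by rw [← CommRingCat.hom_comp, hab]; rfl) (by rw [← CommRingCat.hom_comp, hba]; rfl)
  have h1 : IsAwayHom (algebraMap R (Localization.Away f)) f := (isAwayHom_iff f).2 inferInstance
  have h2 : ε.toRingHom.comp (algebraMap R (Localization.Away f)) = φ := by
    have : CommRingCat.ofHom (algebraMap R (Localization.Away f)) ≫ b = CommRingCat.ofHom φ :=
      Spec.map_injective (by rw [Spec.map_comp, Spec.map_preimage, he])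
    exact congrArg CommRingCat.Hom.hom this
  rw [← h2]
  exact h1.equiv_comp ε

theorem exists_basic_lift {B : Type} [CommRing B] {O : Scheme.{0}}
    (s : O ⟶ Spec (CommRingCat.of B)) [IsOpenImmersion s] (o : O) :
    ∃ (f : B) (l : Spec (CommRingCat.of (Localization.Away f)) ⟶ O), IsOpenImmersion l ∧
      l ≫ s = Spec.map (CommRingCat.ofHom (algebraMap B (Localization.Away f))) ∧
      o ∈ Set.range l := by
  obtain ⟨_, ⟨f, rfl⟩, hf1, hf2⟩ :=
    PrimeSpectrum.isTopologicalBasis_basic_opens.exists_subset_of_mem_open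
    (show s o ∈ s.opensRange.carrier from ⟨o, rfl⟩) s.opensRange.isOpen
  let j := Spec.map (CommRingCat.ofHom (algebraMap B (Localization.Away f)))
  have hj : Set.range j = (PrimeSpectrum.basicOpen f).carrier :=
    PrimeSpectrum.localization_away_comap_range _ f
  have hle : Set.range j ⊆ Set.range s := by rw [hj]; exact hf2
  let l := IsOpenImmersion.lift s j hle
  have hl : l ≫ s = j := IsOpenImmersion.lift_fac s j hle
  have : IsOpenImmersion (l ≫ s) := by rw [hl]; infer_instance
  refine ⟨f, l, IsOpenImmersion.of_comp l s, hl, ?_⟩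
  have : s o ∈ Set.range j := by rw [hj]; exact hf1
  obtain ⟨x, hx⟩ := this
  refine ⟨x, s.isOpenEmbedding.injective ?_⟩
  rw [← hx, ← hl]
  rfl

theorem common_localization {L B C : Type} [Field L] [CommRing B] [Algebra L B] [CommRing C]
    [Algebra L C] (O : Scheme.{0}) [Nonempty O]
    (β : O ⟶ Spec (CommRingCat.of B)) (γ : O ⟶ Spec (CommRingCat.of C))
    [IsOpenImmersion β] [IsOpenImmersion γ]
    (h : β ≫ Spec.map (CommRingCat.ofHom (algebraMap L B)) =
      γ ≫ Spec.map (CommRingCat.ofHom (algebraMap L C))) :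
    ∃ (E : Type) (_ : CommRing E) (_ : Algebra L E) (β' : B →ₐ[L] E) (f : B) (γ' : C →ₐ[L] E)
      (g : C), Nontrivial E ∧ IsAwayHom (β' : B →+* E) f ∧ IsAwayHom (γ' : C →+* E) g := by
  obtain ⟨o⟩ := ‹Nonempty O›
  obtain ⟨f, l, _, hl, p, hp⟩ := exists_basic_lift β o
  obtain ⟨g, t, _, ht, q, hq⟩ := exists_basic_lift (l ≫ γ) p
  let σ : C →+* Localization.Away f := (Spec.preimage (l ≫ γ)).hom
  let τ : Localization.Away f →+* Localization.Away g := (Spec.preimage t).hom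
  have hσ : Spec.map (CommRingCat.ofHom σ) = l ≫ γ := Spec.map_preimage _
  have hτ : Spec.map (CommRingCat.ofHom τ) = t := Spec.map_preimage _
  have hoi : IsOpenImmersion (Spec.map (CommRingCat.ofHom τ)) := by rw [hτ]; infer_instance
  have hτa : IsAwayHom τ (σ g) := by
    refine isAwayHom_of_range τ (σ g) ?_
    have hj : Set.range (t ≫ l ≫ γ) = (PrimeSpectrum.basicOpen g).carrier := by
      rw [ht]
      exact PrimeSpectrum.localization_away_comap_range _ g
    have key : ∀ x, (l ≫ γ) x ∈ (PrimeSpectrum.basicOpen g).carrier ↔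
        x ∈ (PrimeSpectrum.basicOpen (σ g)).carrier := by
      intro x
      rw [← hσ]
      rfl
    ext x
    refine Iff.trans ?_ (key x)
    rw [← hj]
    have hx : x ∈ Set.range (Spec.map (CommRingCat.ofHom τ)) ↔ x ∈ Set.range t := by rw [hτ]
    refine Iff.trans hx ?_
    constructor
    · rintro ⟨y, rfl⟩
      exact ⟨y, rfl⟩
    · rintro ⟨y, hy⟩
      exact ⟨y, (l ≫ γ).isOpenEmbedding.injective hy⟩
  let : Algebra L (Localization.Away g) :=
    ((algebraMap C (Localization.Away g)).comp (algebraMap L C)).toAlgebra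
  have hL : (τ.comp (algebraMap B (Localization.Away f))).comp (algebraMap L B) =
      (algebraMap C (Localization.Away g)).comp (algebraMap L C) := by
    have : CommRingCat.ofHom (algebraMap L B) ≫
        CommRingCat.ofHom (algebraMap B (Localization.Away f)) ≫ CommRingCat.ofHom τ =
        CommRingCat.ofHom (algebraMap L C) ≫
          CommRingCat.ofHom (algebraMap C (Localization.Away g)) := by
      apply Spec.map_injective
      rw [Spec.map_comp, Spec.map_comp, Spec.map_comp, hτ, ← hl, ← ht]
      simp only [Category.assoc, h]
    exact congrArg CommRingCat.Hom.hom this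
  let β' : B →ₐ[L] Localization.Away g :=
    { τ.comp (algebraMap B (Localization.Away f)) with
      commutes' := fun x => congrArg (fun φ : L →+* Localization.Away g => φ x) hL }
  let γ' : C →ₐ[L] Localization.Away g :=
    { algebraMap C (Localization.Away g) with
      commutes' := fun x => rfl }
  obtain ⟨r, b, hb⟩ := IsLocalization.Away.surj f (σ g)
  have hβ' : IsAwayHom (τ.comp (algebraMap B (Localization.Away f))) (f * b) := by
    let := τ.toAlgebra
    let : Algebra B (Localization.Away g) :=
      (τ.comp (algebraMap B (Localization.Away f))).toAlgebra
    have : IsScalarTower B (Localization.Away f) (Localization.Away g) :=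
      .of_algebraMap_eq fun _ => rfl
    have : IsLocalization.Away (σ g) (Localization.Away g) := (isAwayHom_iff _).1 hτa
    have hu : IsUnit (algebraMap B (Localization.Away f) f ^ r) :=
      (IsLocalization.Away.algebraMap_isUnit f).pow r
    have ha : Associated (algebraMap B (Localization.Away f) b) (σ g) := by
      rw [← hb]
      exact (associated_mul_unit_right (σ g) _ hu).symm
    exact (isAwayHom_iff _).2 (IsLocalization.Away.mul_of_associated f b (σ g) ha)
  refine ⟨Localization.Away g, inferInstance, inferInstance, β', f * b, γ', g, ?_, hβ',
    (isAwayHom_iff g).2 inferInstance⟩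
  exact (PrimeSpectrum.nonempty_iff_nontrivial).1 ⟨q⟩

theorem common_of_iso {L B C : Type} [Field L] [CommRing B] [Algebra L B] [CommRing C]
    [Algebra L C] {Y Z : Scheme.{0}} (y : Y ⟶ Spec (CommRingCat.of L))
    (z : Z ⟶ Spec (CommRingCat.of L)) (U : Y.Opens) (V : Z.Opens) (e : U.toScheme ≅ V.toScheme)
    (he : e.hom ≫ V.ι ≫ z = U.ι ≫ y)
    (a : Spec (CommRingCat.of B) ⟶ Y) (c : Spec (CommRingCat.of C) ⟶ Z)
    [IsOpenImmersion a] [IsOpenImmersion c]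
    (ha : a ≫ y = Spec.map (CommRingCat.ofHom (algebraMap L B)))
    (hc : c ≫ z = Spec.map (CommRingCat.ofHom (algebraMap L C)))
    (u : U.toScheme) (hu : U.ι u ∈ Set.range a) (hv : (e.hom ≫ V.ι) u ∈ Set.range c) :
    ∃ (E : Type) (_ : CommRing E) (_ : Algebra L E) (β' : B →ₐ[L] E) (f : B) (γ' : C →ₐ[L] E)
      (g : C), Nontrivial E ∧ IsAwayHom (β' : B →+* E) f ∧ IsAwayHom (γ' : C →+* E) g := by
  obtain ⟨b0, hb0⟩ := hu
  obtain ⟨c0, hc0⟩ := hv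
  obtain ⟨m, hm1, hm2⟩ := Scheme.Pullback.exists_preimage_pullback (f := U.ι) (g := a) u b0 hb0.symm
  obtain ⟨n, hn1, hn2⟩ :=
    Scheme.Pullback.exists_preimage_pullback (f := e.hom ≫ V.ι) (g := c) u c0 hc0.symm
  obtain ⟨o, ho1, ho2⟩ := Scheme.Pullback.exists_preimage_pullback
    (f := pullback.fst U.ι a) (g := pullback.fst (e.hom ≫ V.ι) c) m n (hm1.trans hn1.symm)
  have : Nonempty (pullback (pullback.fst U.ι a) (pullback.fst (e.hom ≫ V.ι) c) : Scheme.{0}) := ⟨o⟩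
  refine common_localization (pullback (pullback.fst U.ι a) (pullback.fst (e.hom ≫ V.ι) c))
    (pullback.fst _ _ ≫ pullback.snd U.ι a) (pullback.snd _ _ ≫ pullback.snd (e.hom ≫ V.ι) c) ?_
  rw [← ha, ← hc, Category.assoc, Category.assoc, ← pullback.condition_assoc,
    ← pullback.condition_assoc, pullback.condition_assoc, Category.assoc, he]

theorem stablyRational_of_common {k : Type} [Field k] {X : Scheme.{0}}
    (pX : X ⟶ Spec (CommRingCat.of k)) (L : Type) [Field L] [Algebra k L] (n m : ℕ)
    {B C D : Type} [CommRing B] [Algebra L B] [CommRing C] [Algebra L C] [CommRing D] [Algebra L D]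
    [Nontrivial D]
    (β : B →ₐ[L] D) (f : B) (γ : C →ₐ[L] D) (g : C)
    (hβ : IsAwayHom (β : B →+* D) f) (hγ : IsAwayHom (γ : C →+* D) g)
    (a : Spec (CommRingCat.of B) ⟶ pullback (bcStruct pX L) (ProjSpace.structMap L n))
    (c : Spec (CommRingCat.of C) ⟶ ProjSpace L m)
    [IsOpenImmersion a] [IsOpenImmersion c]
    (ha : a ≫ pullback.fst (bcStruct pX L) (ProjSpace.structMap L n) ≫ bcStruct pX L =
      Spec.map (CommRingCat.ofHom (algebraMap L B)))
    (hc : c ≫ ProjSpace.structMap L m = Spec.map (CommRingCat.ofHom (algebraMap L C))) :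
    StablyRationalOver pX L := by
  have := hβ.isOpenImmersion
  have := hγ.isOpenImmersion
  let a' := Spec.map (CommRingCat.ofHom (β : B →+* D)) ≫ a
  let c' := Spec.map (CommRingCat.ofHom (γ : C →+* D)) ≫ c
  obtain ⟨d⟩ : Nonempty (Spec (CommRingCat.of D)) :=
    (inferInstance : Nonempty (PrimeSpectrum D))
  refine ⟨n, m, a'.opensRange, c'.opensRange, ?_, ?_,
    a'.isoOpensRange.symm ≪≫ c'.isoOpensRange, ?_⟩
  · intro h
    have : a' d ∈ a'.opensRange := ⟨d, rfl⟩
    rw [h] at this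
    exact this
  · intro h
    have : c' d ∈ c'.opensRange := ⟨d, rfl⟩
    rw [h] at this
    exact this
  · simp only [Iso.trans_hom, Iso.symm_hom, Category.assoc, Scheme.Hom.isoOpensRange_hom_ι_assoc]
    rw [Iso.inv_comp_eq, Scheme.Hom.isoOpensRange_hom_ι_assoc]
    simp only [a', c', Category.assoc]
    rw [ha, hc, ← Spec.map_comp, ← Spec.map_comp, ← CommRingCat.ofHom_comp,
      ← CommRingCat.ofHom_comp, AlgHom.comp_algebraMap, AlgHom.comp_algebraMap]

end GeoPart

section ChartPart
open TensorProduct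

/-- an affine chart with prescribed coordinate ring and prescribed image -/
def IsChart {S : Type} [CommRing S] {Y : Scheme.{0}} (y : Y ⟶ Spec (CommRingCat.of S))
    (A : Type) [CommRing A] [Algebra S A] (W : Set Y) : Prop :=
  ∃ a : Spec (CommRingCat.of A) ⟶ Y, IsOpenImmersion a ∧
    a ≫ y = Spec.map (CommRingCat.ofHom (algebraMap S A)) ∧ Set.range a = W

theorem IsChart.congr {S : Type} [CommRing S] {Y : Scheme.{0}} {y : Y ⟶ Spec (CommRingCat.of S)}
    {A A' : Type} [CommRing A] [Algebra S A] [CommRing A'] [Algebra S A'] {W : Set Y}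
    (h : IsChart y A W) (φ : A ≃ₐ[S] A') : IsChart y A' W := by
  obtain ⟨a, h1, h2, h3⟩ := h
  let i : Spec (CommRingCat.of A') ≅ Spec (CommRingCat.of A) :=
    Scheme.Spec.mapIso (φ.toRingEquiv.toCommRingCatIso).op
  have hi : i.hom = Spec.map (CommRingCat.ofHom (φ : A →+* A')) := rfl
  refine ⟨i.hom ≫ a, inferInstance, ?_, ?_⟩
  · rw [Category.assoc, h2, hi, ← Spec.map_comp, ← CommRingCat.ofHom_comp]
    congr 2
    ext x
    simp
  · rw [← h3, Scheme.Hom.comp_base, TopCat.coe_comp]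
    exact (i.hom.surjective).range_comp _

theorem prod_chart {S A B : Type} [CommRing S] [CommRing A] [Algebra S A] [CommRing B] [Algebra S B]
    {Y Z : Scheme.{0}} (y : Y ⟶ Spec (CommRingCat.of S)) (z : Z ⟶ Spec (CommRingCat.of S))
    (a : Spec (CommRingCat.of A) ⟶ Y) (b : Spec (CommRingCat.of B) ⟶ Z)
    [IsOpenImmersion a] [IsOpenImmersion b]
    (ha : a ≫ y = Spec.map (CommRingCat.ofHom (algebraMap S A)))
    (hb : b ≫ z = Spec.map (CommRingCat.ofHom (algebraMap S B))) :
    ∃ c : Spec (CommRingCat.of (A ⊗[S] B)) ⟶ pullback y z, IsOpenImmersion c ∧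
      c ≫ pullback.fst y z = Spec.map (CommRingCat.ofHom (algebraMap A (A ⊗[S] B))) ≫ a ∧
      c ≫ pullback.snd y z = Spec.map (CommRingCat.ofHom
        (Algebra.TensorProduct.includeRight : B →ₐ[S] A ⊗[S] B).toRingHom) ≫ b ∧
      Set.range c = pullback.fst y z ⁻¹' Set.range a ∩ pullback.snd y z ⁻¹' Set.range b := by
  let m := pullback.map (Spec.map (CommRingCat.ofHom (algebraMap S A)))
    (Spec.map (CommRingCat.ofHom (algebraMap S B))) y z a b (𝟙 _) (by simp [ha]) (by simp [hb])
  refine ⟨(pullbackSpecIso S A B).inv ≫ m, inferInstance, ?_, ?_, ?_⟩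
  · simp only [m, Category.assoc, pullback.map, pullback.lift_fst]
    rw [pullbackSpecIso_inv_fst_assoc]
  · simp only [m, Category.assoc, pullback.map, pullback.lift_snd]
    rw [pullbackSpecIso_inv_snd_assoc]
    rfl
  · rw [← Scheme.Pullback.range_map (Spec.map (CommRingCat.ofHom (algebraMap S A)))
      (Spec.map (CommRingCat.ofHom (algebraMap S B))) y z a b (𝟙 _) (by simp [ha]) (by simp [hb])]
    rw [Scheme.Hom.comp_base, TopCat.coe_comp]
    exact ((pullbackSpecIso S A B).inv.surjective).range_comp _

theorem proj_chart (k L : Type) [Field k] [Field L] [Algebra k L] (n : ℕ) (i : Fin (n + 1)) :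
    IsChart (ProjSpace.structMap L n) (L ⊗[k] MvPolynomial {j : Fin (n + 1) // j ≠ i} k)
      (Proj.basicOpen (MvPolynomial.homogeneousSubmodule (Fin (n + 1)) L)
        (MvPolynomial.X i)).carrier := by
  suffices h : IsChart (ProjSpace.structMap L n) (MvPolynomial {j : Fin (n + 1) // j ≠ i} L)
      (Proj.basicOpen (MvPolynomial.homogeneousSubmodule (Fin (n + 1)) L)
        (MvPolynomial.X i)).carrier from
    h.congr (MvPolynomial.algebraTensorAlgEquiv k L).symm
  let : Algebra L (AwayRing L n i) := (constHom L n i).toAlgebra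
  let ρ : MvPolynomial {j : Fin (n + 1) // j ≠ i} L ≃ₐ[L] AwayRing L n i :=
    AlgEquiv.ofRingEquiv (f := RingEquiv.ofBijective _ (chartHom_bijective L n i)) fun x => by
      simp only [RingEquiv.coe_ofBijective, chartHom]
      exact MvPolynomial.eval₂Hom_C _ _ _
  refine IsChart.congr ?_ ρ.symm
  refine ⟨Proj.awayι (MvPolynomial.homogeneousSubmodule (Fin (n + 1)) L) (MvPolynomial.X i)
    (X_mem L n i) one_pos, ?_, ?_, ?_⟩
  · exact inferInstanceAs (IsOpenImmersion (Proj.awayι _ _ _ _))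
  · rw [ProjSpace.structMap]
    erw [Proj.awayι_toSpecZero_assoc]
    rw [← Spec.map_comp]
    rfl
  · exact congrArg (fun U : (Proj (MvPolynomial.homogeneousSubmodule (Fin (n + 1)) L)).Opens =>
      U.carrier) (Proj.opensRange_awayι _ _ _ _)

theorem proj_cover (L : Type) [Field L] (n : ℕ) (x : ProjSpace L n) :
    ∃ i : Fin (n + 1), x ∈ (Proj.basicOpen (MvPolynomial.homogeneousSubmodule (Fin (n + 1)) L)
        (MvPolynomial.X i)).carrier := by
  have h := Proj.iSup_basicOpen_eq_top' (MvPolynomial.homogeneousSubmodule (Fin (n + 1)) L)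
    (fun i : Fin (n + 1) => (MvPolynomial.X i : MvPolynomial (Fin (n + 1)) L))
    (fun i => ⟨1, X_mem L n i⟩) (by
      rw [eq_top_iff]
      intro p _
      have hp : p ∈ Algebra.adjoin L (Set.range
        (MvPolynomial.X : Fin (n + 1) → MvPolynomial (Fin (n + 1)) L)) := by
        rw [MvPolynomial.adjoin_range_X]; trivial
      induction hp using Algebra.adjoin_induction with
      | mem x hx => exact Algebra.subset_adjoin hx
      | algebraMap r => 
          exact Subalgebra.algebraMap_mem (Algebra.adjoin
            (MvPolynomial.homogeneousSubmodule (Fin (n + 1)) L 0) _)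
            (algebraMap L (MvPolynomial.homogeneousSubmodule (Fin (n + 1)) L 0) r)
      | add x y _ _ h1 h2 => exact add_mem (h1 trivial) (h2 trivial)
      | mul x y _ _ h1 h2 => exact mul_mem (h1 trivial) (h2 trivial))
  have hx : x ∈ (⊤ : (Proj (MvPolynomial.homogeneousSubmodule (Fin (n + 1)) L)).Opens) := trivial
  rw [← h] at hx
  exact TopologicalSpace.Opens.mem_iSup.1 hx

theorem bc_chart {k : Type} [Field k] {X : Scheme.{0}} (pX : X ⟶ Spec (CommRingCat.of k))
    {R : Type} [CommRing R] [Algebra k R] {W : Set X} (hW : IsChart pX R W)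
    (L : Type) [Field L] [Algebra k L] :
    IsChart (bcStruct pX L) (L ⊗[k] R) (pullback.fst pX (specMap k L) ⁻¹' W) := by
  obtain ⟨w, _, hw, rfl⟩ := hW
  obtain ⟨c, h1, h2, h3, h4⟩ := prod_chart pX (specMap k L) w (𝟙 _) hw (Category.id_comp _)
  let : Algebra L (R ⊗[k] L) :=
    (Algebra.TensorProduct.includeRight : L →ₐ[k] R ⊗[k] L).toRingHom.toAlgebra
  have h : IsChart (bcStruct pX L) (R ⊗[k] L) (pullback.fst pX (specMap k L) ⁻¹' Set.range w) := by
    refine ⟨c, h1, ?_, ?_⟩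
    · exact h3.trans (Category.comp_id _)
    · refine h4.trans ?_
      simp
      rfl
  exact h.congr (AlgEquiv.ofRingEquiv (f := (Algebra.TensorProduct.comm k R L).toRingEquiv)
    fun x => Algebra.TensorProduct.comm_tmul _ _ _)

theorem total_chart {k : Type} [Field k] {X : Scheme.{0}} (pX : X ⟶ Spec (CommRingCat.of k))
    {R : Type} [CommRing R] [Algebra k R] {W : Set X} (hW : IsChart pX R W)
    (L : Type) [Field L] [Algebra k L] (n : ℕ) (i : Fin (n + 1)) :
    IsChart (pullback.fst (bcStruct pX L) (ProjSpace.structMap L n) ≫ bcStruct pX L)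
      (L ⊗[k] (R ⊗[k] MvPolynomial {j : Fin (n + 1) // j ≠ i} k))
      (pullback.fst (bcStruct pX L) (ProjSpace.structMap L n) ⁻¹'
          (pullback.fst pX (specMap k L) ⁻¹' W) ∩
        pullback.snd (bcStruct pX L) (ProjSpace.structMap L n) ⁻¹'
          (Proj.basicOpen (MvPolynomial.homogeneousSubmodule (Fin (n + 1)) L)
            (MvPolynomial.X i)).carrier) := by
  obtain ⟨a, _, ha, ha'⟩ := bc_chart pX hW L
  obtain ⟨b, _, hb, hb'⟩ := proj_chart k L n i
  obtain ⟨c, h1, h2, h3, h4⟩ := prod_chart _ _ a b ha hb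
  rw [ha', hb'] at h4
  have h : IsChart (pullback.fst (bcStruct pX L) (ProjSpace.structMap L n) ≫ bcStruct pX L)
      ((L ⊗[k] R) ⊗[L] (L ⊗[k] MvPolynomial {j : Fin (n + 1) // j ≠ i} k)) (Set.range c) := by
    refine ⟨c, h1, ?_, rfl⟩
    rw [reassoc_of% h2, ha, ← Spec.map_comp, ← CommRingCat.ofHom_comp, ← IsScalarTower.algebraMap_eq]
  rw [← h4]
  exact h.congr ((Algebra.TensorProduct.cancelBaseChange k L L (L ⊗[k] R)
    (MvPolynomial {j : Fin (n + 1) // j ≠ i} k)).trans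
    (Algebra.TensorProduct.assoc k k L L R (MvPolynomial {j : Fin (n + 1) // j ≠ i} k)))

theorem exists_chart {k : Type} [Field k] {X : Scheme.{0}} (pX : X ⟶ Spec (CommRingCat.of k))
    [LocallyOfFiniteType pX] (x : X) :
    ∃ (R : Type) (_ : CommRing R) (_ : Algebra k R) (W : Set X), Algebra.FiniteType k R ∧
      IsChart pX R W ∧ x ∈ W := by
  obtain ⟨R, w, _, hx⟩ : ∃ (R : CommRingCat.{0}) (w : Spec R ⟶ X), IsOpenImmersion w ∧
      x ∈ Set.range w :=
    ⟨_, X.affineOpenCover.f (X.affineOpenCover.idx x), inferInstance, X.affineOpenCover.covers x⟩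
  let φ := Spec.preimage (w ≫ pX)
  have hφ : Spec.map φ = w ≫ pX := Spec.map_preimage _
  have hl : LocallyOfFiniteType (Spec.map φ) := by rw [hφ]; infer_instance
  have hf : φ.hom.FiniteType := (HasRingHomProperty.Spec_iff (P := @LocallyOfFiniteType)).1 hl
  let : Algebra k R := φ.hom.toAlgebra
  exact ⟨R, inferInstance, inferInstance, Set.range w, hf, ⟨w, inferInstance, hφ.symm, rfl⟩, hx⟩

theorem main_aux (k : Type) [Field k] (X : Scheme.{0})
    (pX : X ⟶ Spec (CommRingCat.of k)) [LocallyOfFiniteType pX]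
    (L : Type) [Field L] [Algebra k L] (h : StablyRationalOver pX L) :
    ∃ L' : FieldExtension k, FiniteDimensional k L'.carrier ∧
      StablyRationalOver pX L'.carrier := by
  obtain ⟨n, m, U, V, hU, -, e, he⟩ := h
  obtain ⟨u⟩ : Nonempty U.toScheme := by
    obtain ⟨y, hy⟩ := (TopologicalSpace.Opens.ne_bot_iff_nonempty U).1 hU
    exact ⟨⟨y, hy⟩⟩
  obtain ⟨R, _, _, W, hR, hW, hxW⟩ := exists_chart pX (pullback.fst pX (specMap k L)
    (pullback.fst (bcStruct pX L) (ProjSpace.structMap L n) (U.ι u)))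
  obtain ⟨i, hi⟩ := proj_cover L n
    (pullback.snd (bcStruct pX L) (ProjSpace.structMap L n) (U.ι u))
  obtain ⟨i', hi'⟩ := proj_cover L m ((e.hom ≫ V.ι) u)
  obtain ⟨a, _, ha, ha'⟩ := total_chart pX hW L n i
  obtain ⟨c, _, hc, hc'⟩ := proj_chart k L m i'
  obtain ⟨E, _, _, β, f, γ, g, _, hβ, hγ⟩ := common_of_iso _ _ U V e he a c ha hc u
    (by rw [ha']; exact ⟨hxW, hi⟩) (by rw [hc']; exact hi')
  have : Algebra.FiniteType k (R ⊗[k] MvPolynomial {j : Fin (n + 1) // j ≠ i} k) :=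
    Algebra.FiniteType.trans (S := R) hR inferInstance
  obtain ⟨L', _, _, D, _, _, β', f', γ', g', hfin, _, hβ', hγ'⟩ := core_algebra β f hβ γ g hγ
  obtain ⟨a', _, ha, -⟩ := total_chart pX hW L' n i
  obtain ⟨c', _, hc, -⟩ := proj_chart k L' m i'
  exact ⟨⟨L'⟩, hfin, stablyRational_of_common pX L' n m β' f' γ' g' hβ' hγ' a' c' ha hc⟩

end ChartPart

/-- Let `X` be a geometrically integral `k`-variety. If `X_L`
is stably `L`-rational for some field extension `L/k`, then `X_{L'}` is stably
`L'`-rational for some finite extension `L'/k`. -/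
theorem stmt4 (k : Type) [Field k] (X : Scheme.{0})
    (pX : X ⟶ Spec (CommRingCat.of k))
    [IsSeparated pX] [LocallyOfFiniteType pX] [QuasiCompact pX]
    (hgX : ∀ (F : Type) [Field F] [Algebra k F], IsIntegral (bc pX F))
    (h : ∃ L : FieldExtension k, StablyRationalOver pX L.carrier) :
    ∃ L' : FieldExtension k, FiniteDimensional k L'.carrier ∧
      StablyRationalOver pX L'.carrier := by
  obtain ⟨L, hL⟩ := h
  exact main_aux k X pX L.carrier hL
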